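/- arXiv:2410.20918 — 3 statements merged into one kernel-verified Lean document; each statement's English description precedes it below -/
import Mathlib

section
/- Let X be a real random variable with cdf F, let 1 ≤ p < ∞, and for x ∈ ℝ define 𝕏_x(t) = P(X > t) − 1{x > t}, t ∈ ℝ. Then for every x ∈ ℝ, ∫_ℝ |𝕏_x(t)|^p dt = ∫_{(−∞,x)} F(t)^p dt + ∫_{[x,∞)} (1 − F(t))^p dt; moreover, for every c ∈ ℝ with 0 < F(c) < 1, ∫_ℝ |𝕏_x(t)|^p dt ≥ m_c^p |x − c|, where m_c = min(F(c), 1 − F(c)). -/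
open MeasureTheory Set ENNReal

/-- Let `X` be a real random variable with cdf `F`, `1 ≤ p < ∞`, and for
`x ∈ ℝ` let `𝕏ₓ(t) = P(X > t) − 1{x > t}`. Then
`∫ |𝕏ₓ|^p = ∫_{(−∞,x)} F^p + ∫_{[x,∞)} (1 − F)^p`, and for every `c` with `0 < F c < 1`,
`∫ |𝕏ₓ|^p ≥ (min (F c) (1 − F c))^p * |x − c|`. -/
theorem lintegral_tail_process_eq_and_lower_bound
    {Ω : Type*} [MeasurableSpace Ω] (P : Measure Ω) [IsProbabilityMeasure P]
    (X : Ω → ℝ) (hX : Measurable X)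
    (F : ℝ → ℝ) (hF : ∀ t, F t = (P {ω | X ω ≤ t}).toReal)
    (p : ℝ) (hp : 1 ≤ p)
    (𝕏 : ℝ → ℝ → ℝ)
    (h𝕏 : ∀ x t, 𝕏 x t = (1 - F t) - (if t < x then (1 : ℝ) else 0)) :
    (∀ x : ℝ, ∫⁻ t, ENNReal.ofReal (|𝕏 x t| ^ p)
      = (∫⁻ t in Set.Iio x, ENNReal.ofReal (F t ^ p))
        + ∫⁻ t in Set.Ici x, ENNReal.ofReal ((1 - F t) ^ p)) ∧
    (∀ x c : ℝ, 0 < F c → F c < 1 →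
      ENNReal.ofReal (min (F c) (1 - F c) ^ p * |x - c|)
        ≤ ∫⁻ t, ENNReal.ofReal (|𝕏 x t| ^ p)) := by
  have hmono : Monotone F := fun s t hst => by
    rw [hF, hF]
    exact ENNReal.toReal_mono (measure_ne_top _ _) (measure_mono fun ω hω => le_trans hω hst)
  have hF0 (t : ℝ) : 0 ≤ F t := by rw [hF]; exact ENNReal.toReal_nonneg
  have hF1 (t : ℝ) : F t ≤ 1 := by rw [hF]; exact measureReal_le_one
  have habs_lt {x t : ℝ} (h : t < x) : |𝕏 x t| = F t := by
    rw [h𝕏, if_pos h, sub_sub_cancel_left, abs_neg, abs_of_nonneg (hF0 t)]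
  have habs_ge {x t : ℝ} (h : x ≤ t) : |𝕏 x t| = 1 - F t := by
    rw [h𝕏, if_neg h.not_gt, sub_zero, abs_of_nonneg (sub_nonneg.2 (hF1 t))]
  refine ⟨fun x => ?_, fun x c hc0 hc1 => ?_⟩
  · rw [← lintegral_add_compl _ (measurableSet_Iio (a := x)), compl_Iio]
    congr 1
    · exact setLIntegral_congr_fun measurableSet_Iio fun t ht => by simp only [habs_lt ht]
    · exact setLIntegral_congr_fun measurableSet_Ici fun t ht => by simp only [habs_ge ht]
  · have hm : 0 ≤ min (F c) (1 - F c) := le_min hc0.le (sub_nonneg.2 hc1.le)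
    have hle : ∀ t ∈ Ico (min x c) (max x c), min (F c) (1 - F c) ≤ |𝕏 x t| := by
      rintro t ⟨ht1, ht2⟩
      rcases lt_or_ge t x with h | h
      · have hct : c ≤ t := (min_le_iff.1 ht1).resolve_left h.not_ge
        exact (min_le_left _ _).trans ((hmono hct).trans_eq (habs_lt h).symm)
      · have htc : t < c := (lt_max_iff.1 ht2).resolve_left h.not_gt
        exact (min_le_right _ _).trans
          ((sub_le_sub_left (hmono htc.le) 1).trans_eq (habs_ge h).symm)
    calc ENNReal.ofReal (min (F c) (1 - F c) ^ p * |x - c|)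
        = ∫⁻ _ in Ico (min x c) (max x c), ENNReal.ofReal (min (F c) (1 - F c) ^ p) := by
          rw [setLIntegral_const, Real.volume_Ico, max_sub_min_eq_abs',
            ENNReal.ofReal_mul (Real.rpow_nonneg hm p)]
      _ ≤ ∫⁻ t in Ico (min x c) (max x c), ENNReal.ofReal (|𝕏 x t| ^ p) :=
          setLIntegral_mono' measurableSet_Ico fun t ht => ENNReal.ofReal_le_ofReal
            (Real.rpow_le_rpow hm (hle t ht) (zero_le_one.trans hp))
      _ ≤ ∫⁻ t, ENNReal.ofReal (|𝕏 x t| ^ p) := setLIntegral_le_lintegral _ _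
end

section
/- Let 2 < p < ∞ and let X be a real random variable with cdf F such that ∫_ℝ (F(t)(1 − F(t)))^{p/2} dt < ∞. Define the random element 𝕏(t) = P(X > t) − 1{X > t}, t ∈ ℝ. Then ‖𝕏‖_p < ∞ almost surely and lim_{t→∞} t² P(‖𝕏‖_p > t) = 0. -/
open MeasureTheory Set Filter Topology ENNReal

/-- For a function `f` with values in `[0, 1]` that vanishes at infinity, integrability of
`(f (1 - f)) ^ q` gives integrability of `f ^ q` on the positive half-line. -/
lemma setLIntegral_rpow_lt_top_of_mul_one_sub {f : ℝ → ℝ} {q : ℝ} (hq : 0 < q)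
    (h0 : ∀ t, 0 ≤ f t) (h1 : ∀ t, f t ≤ 1) (hlim : Tendsto f atTop (𝓝 0))
    (hint : ∫⁻ t, ENNReal.ofReal ((f t * (1 - f t)) ^ q) < ⊤) :
    ∫⁻ t in Ioi 0, ENNReal.ofReal (f t ^ q) < ⊤ := by
  obtain ⟨M, hM⟩ := eventually_atTop.1
    (hlim.eventually (Iic_mem_nhds (show (0 : ℝ) < 1 / 2 by norm_num)))
  have hbound : ∀ t ∈ Ioi (0 : ℝ), ENNReal.ofReal (f t ^ q) ≤
      (Icc 0 M).indicator (fun _ => (1 : ℝ≥0∞)) t +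
        ENNReal.ofReal (2 ^ q) * ENNReal.ofReal ((f t * (1 - f t)) ^ q) := by
    intro t ht
    by_cases htM : t ≤ M
    · rw [indicator_of_mem (show t ∈ Icc 0 M from ⟨le_of_lt ht, htM⟩)]
      refine le_add_right ?_
      rw [← ENNReal.ofReal_one]
      exact ENNReal.ofReal_le_ofReal (Real.rpow_le_one (h0 t) (h1 t) hq.le)
    · refine le_add_left ?_
      rw [← ENNReal.ofReal_mul (by positivity)]
      refine ENNReal.ofReal_le_ofReal ?_
      have hhalf : f t ≤ 1 / 2 := hM t (not_le.1 htM).le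
      have := h0 t
      rw [← Real.mul_rpow (by norm_num) (mul_nonneg this (by linarith))]
      exact Real.rpow_le_rpow this (by nlinarith) hq.le
  calc ∫⁻ t in Ioi 0, ENNReal.ofReal (f t ^ q)
      ≤ ∫⁻ t in Ioi 0, ((Icc 0 M).indicator (fun _ => (1 : ℝ≥0∞)) t +
        ENNReal.ofReal (2 ^ q) * ENNReal.ofReal ((f t * (1 - f t)) ^ q)) :=
        setLIntegral_mono' measurableSet_Ioi hbound
    _ ≤ ∫⁻ t, ((Icc 0 M).indicator (fun _ => (1 : ℝ≥0∞)) t +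
        ENNReal.ofReal (2 ^ q) * ENNReal.ofReal ((f t * (1 - f t)) ^ q)) :=
        setLIntegral_le_lintegral _ _
    _ = volume (Icc 0 M) +
        ENNReal.ofReal (2 ^ q) * ∫⁻ t, ENNReal.ofReal ((f t * (1 - f t)) ^ q) := by
        rw [lintegral_add_left (measurable_const.indicator measurableSet_Icc),
          lintegral_const_mul' _ _ ENNReal.ofReal_ne_top, lintegral_indicator measurableSet_Icc,
          setLIntegral_one]
    _ < ⊤ := by
        rw [Real.volume_Icc]
        exact ENNReal.add_lt_top.2
          ⟨ENNReal.ofReal_lt_top, ENNReal.mul_lt_top ENNReal.ofReal_lt_top hint⟩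

/-- A nonnegative antitone function with `f ^ q` integrable at infinity is `o(u ^ (-1 / q))`. -/
lemma tendsto_rpow_mul_of_antitone {f : ℝ → ℝ} {q : ℝ} (hq : 0 < q) (hf : Antitone f)
    (h0 : ∀ t, 0 ≤ f t) (hint : ∫⁻ t in Ioi 0, ENNReal.ofReal (f t ^ q) < ⊤) :
    Tendsto (fun u : ℝ => u ^ q⁻¹ * f u) atTop (𝓝 0) := by
  have hg : Antitone fun t => f t ^ q := fun a b hab => Real.rpow_le_rpow (h0 b) (hf hab) hq.le
  have hI : IntegrableOn (fun t => f t ^ q) (Ioi 0) := by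
    refine ⟨hg.measurable.aestronglyMeasurable, ?_⟩
    rw [hasFiniteIntegral_iff_ofReal (ae_of_all _ fun t => Real.rpow_nonneg (h0 t) q)]
    exact hint
  have hlim : Tendsto (fun u : ℝ => ∫ t in (u / 2)..u, f t ^ q) atTop (𝓝 0) := by
    have h1 := intervalIntegral_tendsto_integral_Ioi 0 hI tendsto_id
    have h2 := intervalIntegral_tendsto_integral_Ioi 0 hI
      (tendsto_id.atTop_div_const (show (0 : ℝ) < 2 by norm_num))
    have h3 := h1.sub h2
    rw [sub_self] at h3
    refine h3.congr fun u => ?_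
    exact intervalIntegral.integral_interval_sub_left hg.intervalIntegrable hg.intervalIntegrable
  have hmul : Tendsto (fun u : ℝ => u * f u ^ q) atTop (𝓝 0) := by
    have h2 := hlim.const_mul 2
    rw [mul_zero] at h2
    refine squeeze_zero' ?_ ?_ h2
    · filter_upwards [eventually_ge_atTop 0] with u hu
      exact mul_nonneg hu (Real.rpow_nonneg (h0 u) q)
    · filter_upwards [eventually_ge_atTop 0] with u hu
      have := intervalIntegral.integral_mono_on (show u / 2 ≤ u by linarith)
        (intervalIntegrable_const (μ := volume) (c := f u ^ q)) hg.intervalIntegrable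
        fun t ht => hg ht.2
      rw [intervalIntegral.integral_const, smul_eq_mul] at this
      linarith
  have hroot := hmul.rpow_const (p := q⁻¹) (Or.inr (by positivity))
  rw [Real.zero_rpow (by positivity)] at hroot
  refine hroot.congr' ?_
  filter_upwards [eventually_ge_atTop 0] with u hu
  rw [Real.mul_rpow hu (Real.rpow_nonneg (h0 u) q), Real.rpow_rpow_inv (h0 u) hq.ne']

/-- The `p`-th power of the norm of `t ↦ 1 - F t - 1{t < x}` grows at most linearly in `x`. -/
lemma eLpNorm_one_sub_sub_indicator_rpow_le {F : ℝ → ℝ} (hmono : Monotone F)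
    (h0 : ∀ t, 0 ≤ F t) (h1 : ∀ t, F t ≤ 1) {p q : ℝ} (hp : 0 < p) (hqp : q ≤ p) (x : ℝ) :
    eLpNorm (fun t => (1 - F t) - if t < x then (1 : ℝ) else 0) (ENNReal.ofReal p) volume ^ p ≤
      ENNReal.ofReal (2 * |x|) + ((∫⁻ t in Ioi 0, ENNReal.ofReal ((1 - F t) ^ q)) +
        ∫⁻ t in Ioi 0, ENNReal.ofReal (F (-t) ^ q)) := by
  have hpow : ∀ a : ℝ, 0 ≤ a → a ≤ 1 → ENNReal.ofReal a ^ p ≤ ENNReal.ofReal (a ^ q) := by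
    intro a ha ha1
    rw [ENNReal.ofReal_rpow_of_nonneg ha hp.le]
    refine ENNReal.ofReal_le_ofReal ?_
    rcases ha.eq_or_lt with rfl | ha
    · rw [Real.zero_rpow hp.ne']
      exact Real.rpow_nonneg le_rfl q
    · exact Real.rpow_le_rpow_of_exponent_ge ha ha1 hqp
  have hR : Measurable fun t => ENNReal.ofReal ((1 - F t) ^ q) :=
    ((measurable_const.sub hmono.measurable).pow_const q).ennreal_ofReal
  have hL : ∫⁻ t in Ioi 0, ENNReal.ofReal (F (-t) ^ q) =
      ∫⁻ t, (Iio 0).indicator (fun t => ENNReal.ofReal (F t ^ q)) t := by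
    rw [← lintegral_indicator measurableSet_Ioi,
      ← (Measure.measurePreserving_neg (volume : Measure ℝ)).lintegral_comp_emb
        (MeasurableEquiv.neg ℝ).measurableEmbedding]
    refine lintegral_congr fun t => ?_
    simp [indicator]
  have hvol : ENNReal.ofReal (2 * |x|) =
      ∫⁻ t, (Icc (-|x|) |x|).indicator (fun _ => (1 : ℝ≥0∞)) t := by
    rw [lintegral_indicator measurableSet_Icc, setLIntegral_one, Real.volume_Icc]
    congr 1
    ring
  rw [eLpNorm_eq_lintegral_rpow_enorm_toReal (by simpa using hp) ENNReal.ofReal_ne_top,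
    ENNReal.toReal_ofReal hp.le, ← ENNReal.rpow_mul, one_div, inv_mul_cancel₀ hp.ne',
    ENNReal.rpow_one, hL, hvol, ← lintegral_indicator measurableSet_Ioi,
    ← lintegral_add_left (hR.indicator measurableSet_Ioi),
    ← lintegral_add_left (measurable_const.indicator measurableSet_Icc)]
  refine lintegral_mono fun t => ?_
  have h0t := h0 t
  have h1t := h1 t
  simp only [Real.enorm_eq_ofReal_abs]
  by_cases ht : t ∈ Icc (-|x|) |x|
  · rw [indicator_of_mem ht]
    refine le_add_right (ENNReal.rpow_le_one ?_ hp.le)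
    rw [← ENNReal.ofReal_one]
    refine ENNReal.ofReal_le_ofReal (abs_le.2 ?_)
    split_ifs <;> constructor <;> linarith
  · refine le_add_left ?_
    rw [mem_Icc, not_and_or, not_le, not_le] at ht
    rcases ht with ht | ht
    · have htx : t < x := ht.trans_le (neg_abs_le x)
      have ht0 : t ∈ Iio (0 : ℝ) := ht.trans_le (neg_nonpos.2 (abs_nonneg x))
      rw [indicator_of_mem ht0, if_pos htx,
        show (1 - F t) - 1 = -F t by ring, abs_neg, abs_of_nonneg h0t]
      exact le_add_left (hpow _ h0t h1t)
    · have htx : ¬ t < x := not_lt.2 ((le_abs_self x).trans ht.le)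
      have ht0 : t ∈ Ioi (0 : ℝ) := (abs_nonneg x).trans_lt ht
      rw [indicator_of_mem ht0, if_neg htx, sub_zero, abs_of_nonneg (by linarith)]
      exact le_add_right (hpow _ (by linarith) (by linarith))

/-- Let `2 < p < ∞` and let `X` be a real random variable with cdf `F`
such that `∫ (F (1 − F))^(p/2) < ∞`. With `𝕏(t) = P(X > t) − 1{X > t}`, we have
`‖𝕏‖_p < ∞` a.s. and `t² P(‖𝕏‖_p > t) → 0` as `t → ∞`. -/
theorem norm_tail_process_finite_and_tail_decay
    {Ω : Type*} [MeasurableSpace Ω] (P : Measure Ω) [IsProbabilityMeasure P]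
    (X : Ω → ℝ) (hX : Measurable X)
    (F : ℝ → ℝ) (hF : ∀ t, F t = (P {ω | X ω ≤ t}).toReal)
    (p : ℝ) (hp : 2 < p)
    (hint : ∫⁻ t, ENNReal.ofReal ((F t * (1 - F t)) ^ (p / 2)) < ⊤) :
    (∀ᵐ ω ∂P, eLpNorm (fun t => (1 - F t) - if t < X ω then (1 : ℝ) else 0)
      (ENNReal.ofReal p) (volume : Measure ℝ) < ⊤) ∧
    Tendsto (fun s : ℝ => s ^ 2 *
      (P {ω | ENNReal.ofReal s < eLpNorm (fun t => (1 - F t) - if t < X ω then (1 : ℝ) else 0)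
        (ENNReal.ofReal p) (volume : Measure ℝ)}).toReal) atTop (𝓝 0) := by
  have : IsProbabilityMeasure (P.map X) := Measure.isProbabilityMeasure_map hX.aemeasurable
  have hcdf : F = ProbabilityTheory.cdf (P.map X) := by
    funext t
    rw [hF, ProbabilityTheory.cdf_eq_real, measureReal_def, Measure.map_apply hX measurableSet_Iic]
    rfl
  have hmono : Monotone F := hcdf ▸ ProbabilityTheory.monotone_cdf _
  have h0 : ∀ t, 0 ≤ F t := hcdf ▸ ProbabilityTheory.cdf_nonneg _
  have h1 : ∀ t, F t ≤ 1 := hcdf ▸ ProbabilityTheory.cdf_le_one _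
  have hbot : Tendsto F atBot (𝓝 0) := hcdf ▸ ProbabilityTheory.tendsto_cdf_atBot _
  have htop : Tendsto F atTop (𝓝 1) := hcdf ▸ ProbabilityTheory.tendsto_cdf_atTop _
  have hp0 : 0 < p := by linarith
  have hq : 0 < p / 2 := by linarith
  have hR : ∫⁻ t in Ioi 0, ENNReal.ofReal ((1 - F t) ^ (p / 2)) < ⊤ := by
    refine setLIntegral_rpow_lt_top_of_mul_one_sub hq (fun t => sub_nonneg.2 (h1 t))
      (fun t => sub_le_self _ (h0 t)) (by simpa using htop.const_sub 1) ?_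
    simpa only [_root_.sub_sub_cancel, mul_comm (1 - F _)] using hint
  have hL : ∫⁻ t in Ioi 0, ENNReal.ofReal (F (-t) ^ (p / 2)) < ⊤ := by
    refine setLIntegral_rpow_lt_top_of_mul_one_sub hq (fun t => h0 _) (fun t => h1 _)
      (hbot.comp tendsto_neg_atTop_atBot) ?_
    rwa [(Measure.measurePreserving_neg (volume : Measure ℝ)).lintegral_comp_emb
        (MeasurableEquiv.neg ℝ).measurableEmbedding
        fun t => ENNReal.ofReal ((F t * (1 - F t)) ^ (p / 2))]
  have hnorm := eLpNorm_one_sub_sub_indicator_rpow_le hmono h0 h1 hp0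
    (show p / 2 ≤ p by linarith)
  have hC := (ENNReal.add_lt_top.2 ⟨hR, hL⟩).ne
  obtain ⟨C, hC0, hCeq⟩ : ∃ C : ℝ, 0 ≤ C ∧ (∫⁻ t in Ioi 0, ENNReal.ofReal ((1 - F t) ^ (p / 2))) +
      ∫⁻ t in Ioi 0, ENNReal.ofReal (F (-t) ^ (p / 2)) = ENNReal.ofReal C :=
    ⟨_, ENNReal.toReal_nonneg, (ENNReal.ofReal_toReal hC).symm⟩
  simp only [hCeq] at hnorm
  refine ⟨ae_of_all _ fun ω => ?_, ?_⟩
  · refine (ENNReal.rpow_lt_top_iff_of_pos hp0).1 ((hnorm (X ω)).trans_lt ?_)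
    exact ENNReal.add_lt_top.2 ⟨ENNReal.ofReal_lt_top, ENNReal.ofReal_lt_top⟩
  have hdecay : Tendsto (fun u : ℝ => u ^ (p / 2)⁻¹ * (F (-u) + (1 - F u))) atTop (𝓝 0) := by
    have hl := tendsto_rpow_mul_of_antitone hq
      (fun a b hab => hmono (neg_le_neg hab)) (fun t => h0 (-t)) hL
    have hr := tendsto_rpow_mul_of_antitone hq
      (fun a b hab => sub_le_sub_left (hmono hab) 1) (fun t => sub_nonneg.2 (h1 t)) hR
    simpa only [mul_add, add_zero] using hl.add hr
  have htail : ∀ u, (P {ω | u < |X ω|}).toReal ≤ F (-u) + (1 - F u) := by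
    intro u
    have hcompl : 1 - F u = P.real {ω | X ω ≤ u}ᶜ := by
      rw [probReal_compl_eq_one_sub (measurableSet_le hX measurable_const), hF, measureReal_def]
    rw [hcompl, hF, ← measureReal_def, ← measureReal_def]
    refine (measureReal_mono fun ω hω => ?_).trans (measureReal_union_le _ _)
    rcases lt_abs.1 (mem_ofPred.1 hω) with h | h
    · exact Or.inr (not_le.2 h)
    · exact Or.inl (show X ω ≤ -u by linarith)
  have hpow : Tendsto (fun s : ℝ => s ^ p / 4) atTop atTop :=
    (tendsto_rpow_atTop hp0).atTop_div_const (by norm_num)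
  have hlim := (hdecay.comp hpow).const_mul (4 ^ (p / 2)⁻¹)
  rw [mul_zero] at hlim
  refine squeeze_zero' (Eventually.of_forall fun s => by positivity) ?_ hlim
  filter_upwards [eventually_ge_atTop 0, hpow.eventually_ge_atTop (C / 2)] with s hs hsC
  have hscale : (4 : ℝ) ^ (p / 2)⁻¹ * (s ^ p / 4) ^ (p / 2)⁻¹ = s ^ 2 := by
    rw [← Real.mul_rpow (by norm_num) (by positivity), mul_div_cancel₀ _ (by norm_num),
      ← Real.rpow_mul hs, show p * (p / 2)⁻¹ = (2 : ℕ) by field_simp; norm_num,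
      Real.rpow_natCast]
  rw [Function.comp_apply, ← mul_assoc, hscale]
  refine mul_le_mul_of_nonneg_left (le_trans ?_ (htail _)) (sq_nonneg s)
  refine measureReal_mono fun ω hω => ?_
  have hlt := (ENNReal.rpow_lt_rpow (mem_ofPred.1 hω) hp0).trans_le (hnorm (X ω))
  rw [ENNReal.ofReal_rpow_of_nonneg hs hp0.le, ← ENNReal.ofReal_add (by positivity) hC0,
    ENNReal.ofReal_lt_ofReal_iff_of_nonneg (by positivity)] at hlt
  exact mem_ofPred.2 (by linarith)
end

section
/- Let 1 ≤ p < ∞ and let X be a real random variable with cdf F such that E|X|^{2/p} < ∞. Define the random element 𝕏(t) = P(X > t) − 1{X > t}, t ∈ ℝ, and ‖𝕏‖_p = (∫_ℝ |𝕏(t)|^p dt)^{1/p}. Then E[ ‖𝕏‖_p² ] < ∞. -/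
open MeasureTheory Set ENNReal

section Tail

variable {Ω : Type*} [MeasurableSpace Ω] (P : Measure Ω)

/-- Markov's inequality for the moment of order `2 / p`, raised to the power `p`. -/
lemma sq_mul_measureReal_rpow_le [IsProbabilityMeasure P] {X : Ω → ℝ} (hX : Measurable X)
    {p : ℝ} (hp : 0 < p) (hmom : ∫⁻ ω, ENNReal.ofReal (|X ω| ^ (2 / p)) ∂P < ⊤) (t : ℝ) :
    t ^ 2 * P.real {ω | |t| ≤ |X ω|} ^ p ≤
      (∫⁻ ω, ENNReal.ofReal (|X ω| ^ (2 / p)) ∂P).toReal ^ p := by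
  have hmeas : Measurable fun ω => ENNReal.ofReal (|X ω| ^ (2 / p)) := by fun_prop
  have markov := mul_meas_ge_le_lintegral (μ := P) hmeas (ENNReal.ofReal (|t| ^ (2 / p)))
  have hsub : P {ω | |t| ≤ |X ω|} ≤
      P {ω | ENNReal.ofReal (|t| ^ (2 / p)) ≤ ENNReal.ofReal (|X ω| ^ (2 / p))} :=
    measure_mono fun ω (hω : |t| ≤ |X ω|) => ENNReal.ofReal_le_ofReal
      (Real.rpow_le_rpow (abs_nonneg _) hω (by positivity))
  have hreal : |t| ^ (2 / p) * P.real {ω | |t| ≤ |X ω|} ≤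
      (∫⁻ ω, ENNReal.ofReal (|X ω| ^ (2 / p)) ∂P).toReal := by
    have h := ENNReal.toReal_mono hmom.ne ((mul_le_mul_right hsub _).trans markov)
    rwa [ENNReal.toReal_mul, ENNReal.toReal_ofReal (by positivity)] at h
  have hpow := Real.rpow_le_rpow (by positivity) hreal hp.le
  rwa [Real.mul_rpow (by positivity) measureReal_nonneg, ← Real.rpow_mul (abs_nonneg _),
    div_mul_cancel₀ _ hp.ne', Real.rpow_two, sq_abs] at hpow

/-- The mean of `1{t < X} - 1{t < 0}` is dominated by the two-sided tail of `X`. -/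
lemma abs_one_sub_cdf_sub_ite_le [IsProbabilityMeasure P] {X : Ω → ℝ} (hX : Measurable X)
    (t : ℝ) :
    |(1 - P.real {ω | X ω ≤ t}) - if t < 0 then (1 : ℝ) else 0| ≤
      P.real {ω | |t| ≤ |X ω|} := by
  split_ifs with ht
  · rw [sub_sub_cancel_left, abs_neg, abs_of_nonneg measureReal_nonneg]
    refine measureReal_mono fun ω (hω : X ω ≤ t) => ?_
    simp only [mem_ofPred_eq]
    rw [abs_of_neg ht, abs_of_neg (hω.trans_lt ht)]
    linarith
  · rw [sub_zero, ← probReal_compl_eq_one_sub (measurableSet_le hX measurable_const),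
      abs_of_nonneg measureReal_nonneg]
    refine measureReal_mono fun ω hω => ?_
    simp only [mem_compl_iff, mem_ofPred_eq, not_le] at hω ⊢
    rw [abs_of_nonneg (not_lt.1 ht)]
    exact hω.le.trans (le_abs_self _)

lemma measurable_measureReal_le [IsFiniteMeasure P] (X : Ω → ℝ) :
    Measurable fun t : ℝ => P.real {ω | X ω ≤ t} :=
  Monotone.measurable fun _ _ hst => measureReal_mono fun _ hω => le_trans hω hst

lemma eLpNorm_one_sub_cdf_sub_ite_lt_top [IsProbabilityMeasure P] {X : Ω → ℝ}
    (hX : Measurable X) {p : ℝ} (hp : 0 < p)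
    (hmom : ∫⁻ ω, ENNReal.ofReal (|X ω| ^ (2 / p)) ∂P < ⊤) :
    eLpNorm (fun t => (1 - P.real {ω | X ω ≤ t}) - if t < 0 then (1 : ℝ) else 0)
      (ENNReal.ofReal p) (volume : Measure ℝ) < ⊤ := by
  rw [eLpNorm_lt_top_iff_lintegral_rpow_enorm_lt_top (by simpa using hp) ofReal_ne_top,
    ENNReal.toReal_ofReal hp.le]
  set C := (∫⁻ ω, ENNReal.ofReal (|X ω| ^ (2 / p)) ∂P).toReal ^ p
  refine lt_of_le_of_lt (lintegral_mono fun t => ?_)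
    (integrable_inv_one_add_sq.const_mul (1 + C)).lintegral_lt_top
  rw [Real.enorm_eq_ofReal_abs, ENNReal.ofReal_rpow_of_nonneg (abs_nonneg _) hp.le]
  refine ENNReal.ofReal_le_ofReal ?_
  refine (Real.rpow_le_rpow (abs_nonneg _) (abs_one_sub_cdf_sub_ite_le P hX t) hp.le).trans ?_
  rw [← div_eq_mul_inv, le_div_iff₀ (by positivity)]
  have h_one : P.real {ω | |t| ≤ |X ω|} ^ p ≤ 1 :=
    Real.rpow_le_one measureReal_nonneg measureReal_le_one hp.le
  linarith [sq_mul_measureReal_rpow_le P hX hp hmom t]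

end Tail

lemma eLpNorm_ite_sub_ite_le {p : ℝ} (hp : 0 < p) (x : ℝ) :
    eLpNorm (fun t : ℝ => (if t < x then (1 : ℝ) else 0) - if t < 0 then (1 : ℝ) else 0)
      (ENNReal.ofReal p) (volume : Measure ℝ) ≤ ENNReal.ofReal (|x| ^ (1 / p)) := by
  have hdom : ∀ t : ℝ, ‖(if t < x then (1 : ℝ) else 0) - if t < 0 then (1 : ℝ) else 0‖ ≤
      ‖(uIcc 0 x).indicator (fun _ => (1 : ℝ)) t‖ := by
    intro t
    by_cases ht : t ∈ uIcc 0 x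
    · rw [indicator_of_mem ht]
      split_ifs <;> simp
    · rw [indicator_of_notMem ht]
      rw [mem_uIcc] at ht
      split_ifs <;> grind
  refine (eLpNorm_mono hdom).trans ?_
  rw [eLpNorm_indicator_const measurableSet_uIcc (by simpa using hp) ofReal_ne_top,
    Real.volume_interval, sub_zero, ENNReal.toReal_ofReal hp.le,
    ENNReal.ofReal_rpow_of_nonneg (abs_nonneg _) (by positivity)]
  simp

/-- Let `1 ≤ p < ∞` and let `X` be a real random variable with cdf `F`
such that `E |X|^(2/p) < ∞`. With `𝕏(t) = P(X > t) − 1{X > t}`, we have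
`E[‖𝕏‖_p²] < ∞`. -/
theorem sq_norm_tail_process_integrable
    {Ω : Type*} [MeasurableSpace Ω] (P : Measure Ω) [IsProbabilityMeasure P]
    (X : Ω → ℝ) (hX : Measurable X)
    (F : ℝ → ℝ) (hF : ∀ t, F t = (P {ω | X ω ≤ t}).toReal)
    (p : ℝ) (hp : 1 ≤ p)
    (hmom : ∫⁻ ω, ENNReal.ofReal (|X ω| ^ (2 / p)) ∂P < ⊤) :
    ∫⁻ ω, (eLpNorm (fun t => (1 - F t) - if t < X ω then (1 : ℝ) else 0)
      (ENNReal.ofReal p) (volume : Measure ℝ)) ^ 2 ∂P < ⊤ := by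
  have hp0 : 0 < p := one_pos.trans_le hp
  obtain rfl : F = fun t => P.real {ω | X ω ≤ t} := funext hF
  set a : ℝ → ℝ := fun t => (1 - P.real {ω | X ω ≤ t}) - if t < 0 then (1 : ℝ) else 0 with ha
  have hite : ∀ x : ℝ, Measurable fun t : ℝ => if t < x then (1 : ℝ) else 0 := fun x =>
    Measurable.ite measurableSet_Iio measurable_const measurable_const
  have ha_meas : Measurable a := ((measurable_measureReal_le P X).const_sub 1).sub (hite 0)
  have hA : eLpNorm a (ENNReal.ofReal p) volume < ⊤ :=
    eLpNorm_one_sub_cdf_sub_ite_lt_top P hX hp0 hmom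
  set A := eLpNorm a (ENNReal.ofReal p) volume
  have hbound : ∀ ω, (eLpNorm (fun t => (1 - P.real {ω | X ω ≤ t}) -
      if t < X ω then (1 : ℝ) else 0) (ENNReal.ofReal p) (volume : Measure ℝ)) ^ 2 ≤
      2 * A ^ 2 + 2 * ENNReal.ofReal (|X ω| ^ (2 / p)) := by
    intro ω
    have hsplit : (fun t => (1 - P.real {ω | X ω ≤ t}) - if t < X ω then (1 : ℝ) else 0) =
        a - fun t => (if t < X ω then (1 : ℝ) else 0) - if t < 0 then (1 : ℝ) else 0 := by
      ext t
      simp [ha]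
    have htri := (eLpNorm_sub_le (μ := volume) ha_meas.aestronglyMeasurable
      ((hite (X ω)).sub (hite 0)).aestronglyMeasurable
      (ENNReal.one_le_ofReal.2 hp)).trans (add_le_add_right (eLpNorm_ite_sub_ite_le hp0 (X ω)) A)
    have hsq : ENNReal.ofReal (|X ω| ^ (2 / p)) = ENNReal.ofReal (|X ω| ^ (1 / p)) ^ 2 := by
      rw [← ENNReal.ofReal_pow (by positivity), ← Real.rpow_mul_natCast (abs_nonneg _)]
      congr 2
      push_cast
      ring
    rw [hsplit, hsq, ← mul_add]
    refine (pow_le_pow_left' htri 2).trans ?_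
    have h := ENNReal.rpow_add_le_mul_rpow_add_rpow A (ENNReal.ofReal (|X ω| ^ (1 / p)))
      one_le_two
    norm_num at h
    simpa using h
  refine (lintegral_mono hbound).trans_lt ?_
  rw [lintegral_add_left measurable_const, lintegral_const, measure_univ, mul_one,
    lintegral_const_mul' _ _ ofNat_ne_top]
  exact ENNReal.add_lt_top.2 ⟨ENNReal.mul_lt_top ofNat_lt_top (ENNReal.pow_lt_top hA),
    ENNReal.mul_lt_top ofNat_lt_top hmom⟩
end
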